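/- Fix disjoint sets X and Y of environment- and agent-controlled variables, a goal G ⊆ (2^{X∪Y})⁺ and an environment specification E ⊆ (2^{X∪Y})⁺, and suppose G is agent enforceable under E, i.e., there exists an agent strategy that enforces G under E. Then an agent strategy σ is best-effort for G under E if and only if σ enforces G under E. In particular, when a winning (enforcing) strategy exists, the best-effort strategies are exactly the winning strategies. -/

import Mathlib

/- Disjoint sets `X` (environment-controlled variables) and `Y` (agent-controlled
variables) are modeled as two types; an element of `Set X` is an environment
choice `Xᵢ ∈ 2^X`, an element of `Set Y` is an agent choice `Yᵢ ∈ 2^Y`, and a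
pair `(Xᵢ, Yᵢ)` is an interpretation in `2^{X∪Y}` (`X` and `Y` being disjoint).
An agent strategy is `σag : (2^X)* → 2^Y`; an environment strategy
`σenv : (2^Y)⁺ → 2^X` is modeled on all finite sequences but only ever applied
to nonempty ones. -/

/-- One step of the construction of the unique trace consistent with both
strategies: given the histories `(X₀…X_{i-1}, Y₀…Y_{i-1})`, the agent plays
`Yᵢ = σag(X₀…X_{i-1})` and the environment answers `Xᵢ = σenv(Y₀…Yᵢ)`. -/
def playStep {X Y : Type*} (σag : List (Set X) → Set Y) (σenv : List (Set Y) → Set X)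
    (h : List (Set X) × List (Set Y)) : List (Set X) × List (Set Y) :=
  let y := σag h.1
  let x := σenv (h.2 ++ [y])
  (h.1 ++ [x], h.2 ++ [y])

/-- `play σag σenv` is the unique infinite trace `π(σag, σenv)` consistent with
both strategies: `Y₀ = σag(ε)`, `Yᵢ = σag(X₀…X_{i-1})` and `Xᵢ = σenv(Y₀…Yᵢ)`.
Instant `i` is read off as the last elements of the histories after `i+1` steps. -/
def play {X Y : Type*} (σag : List (Set X) → Set Y) (σenv : List (Set Y) → Set X)
    (i : ℕ) : Set X × Set Y :=
  let h := (playStep σag σenv)^[i + 1] ([], [])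
  (h.1.getLastD ∅, h.2.getLastD ∅)

/-- The finite nonempty prefix `π₀ … πₙ` of an infinite trace. -/
def prefixTrace {X Y : Type*} (π : ℕ → Set X × Set Y) (n : ℕ) : List (Set X × Set Y) :=
  List.ofFn fun j : Fin (n + 1) => π j

/-- An infinite trace satisfies a goal `G ⊆ (2^{X∪Y})⁺` if some finite nonempty
prefix of it belongs to `G`. -/
def Satisfies {X Y : Type*} (G : Set (List (Set X × Set Y))) (π : ℕ → Set X × Set Y) : Prop :=
  ∃ n : ℕ, prefixTrace π n ∈ G

/-- An environment strategy `σenv` enforces `E` if for every agent strategy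
`σag`, every finite nonempty prefix of `π(σag, σenv)` belongs to `E`. -/
def EnvEnforces {X Y : Type*} (σenv : List (Set Y) → Set X)
    (E : Set (List (Set X × Set Y))) : Prop :=
  ∀ σag : List (Set X) → Set Y, ∀ n : ℕ, prefixTrace (play σag σenv) n ∈ E

/-- An agent strategy `σ` enforces `G` under `E` if for every environment
strategy `σenv` enforcing `E`, the trace `π(σ, σenv)` satisfies `G`. -/
def AgEnforces {X Y : Type*} (σ : List (Set X) → Set Y)
    (G E : Set (List (Set X × Set Y))) : Prop :=
  ∀ σenv : List (Set Y) → Set X, EnvEnforces σenv E → Satisfies G (play σ σenv)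

/-- `σ₁` dominates `σ₂` for `G` under `E` (`σ₁ ≥_{G|E} σ₂`) if for every
environment strategy `σenv` enforcing `E`, `π(σ₂, σenv) ⊨ G` implies
`π(σ₁, σenv) ⊨ G`. -/
def Dominates {X Y : Type*} (G E : Set (List (Set X × Set Y)))
    (σ₁ σ₂ : List (Set X) → Set Y) : Prop :=
  ∀ σenv : List (Set Y) → Set X, EnvEnforces σenv E →
    Satisfies G (play σ₂ σenv) → Satisfies G (play σ₁ σenv)

/-- `σ₁ >_{G|E} σ₂` iff `σ₁ ≥_{G|E} σ₂` and not `σ₂ ≥_{G|E} σ₁`. -/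
def StrictlyDominates {X Y : Type*} (G E : Set (List (Set X × Set Y)))
    (σ₁ σ₂ : List (Set X) → Set Y) : Prop :=
  Dominates G E σ₁ σ₂ ∧ ¬ Dominates G E σ₂ σ₁

/-- `σ` is best-effort for `G` under `E` if no agent strategy strictly dominates it. -/
def BestEffort {X Y : Type*} (G E : Set (List (Set X × Set Y)))
    (σ : List (Set X) → Set Y) : Prop :=
  ¬ ∃ σ' : List (Set X) → Set Y, StrictlyDominates G E σ' σ

/-- If `G` is agent enforceable under `E`, then an agent strategy is best-effort
for `G` under `E` iff it enforces `G` under `E`: when a winning strategy exists,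
the best-effort strategies are exactly the winning strategies. -/
theorem bestEffort_iff_enforcing {X Y : Type*} (G E : Set (List (Set X × Set Y)))
    (h : ∃ σ₀ : List (Set X) → Set Y, AgEnforces σ₀ G E)
    (σ : List (Set X) → Set Y) :
    BestEffort G E σ ↔ AgEnforces σ G E := by
  obtain ⟨σ₀, h₀⟩ := h
  constructor
  · intro hb σenv he
    by_contra hn
    exact hb ⟨σ₀, fun e hE _ => h₀ e hE, fun hd => hn (hd σenv he (h₀ σenv he))⟩
  · rintro hσ ⟨σ', _, hnd⟩
    exact hnd fun e hE _ => hσ e hE
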